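/- Fix k ≥ 2, n ≥ 1 and β ≥ 0. Let P_0 be the law on ⊗^k ℝ^n of a symmetric standard normal tensor Z, and P_β the law of X = β v^{⊗k} + Z with v uniform on S^{n−1} independent of Z. Then P_β is absolutely continuous with respect to P_0, and the Radon–Nikodym derivative Λ = dP_β/dP_0 satisfies E_0[Λ²] = ∫ exp( (nβ²/2) ⟨v, e₁⟩^k ) μ_n(dv), where μ_n is the uniform probability measure on the unit sphere S^{n−1} and E_0 denotes expectation under P_0. -/

import Mathlib

open MeasureTheory ProbabilityTheory Filter
open scoped ENNReal

noncomputable section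

/-- Product of i.i.d. standard Gaussians indexed by `ι`. -/
def stdGaussianPi (ι : Type*) [Fintype ι] : Measure (ι → ℝ) :=
  Measure.pi fun _ => gaussianReal 0 1

/-- The uniform (rotation-invariant) probability measure on the unit sphere `S^{n-1} ⊆ ℝⁿ`,
realized as the law of a normalized standard Gaussian vector. -/
def sphereUniform (n : ℕ) : Measure (EuclideanSpace ℝ (Fin n)) :=
  ((stdGaussianPi (Fin n)).map
      fun x => ((EuclideanSpace.equiv (Fin n) ℝ).symm x : EuclideanSpace ℝ (Fin n))).map
    fun v => ‖v‖⁻¹ • v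

/-- Symmetric standard normal noise tensor: `Z = (1/k!)·√(2/n)·Σ_{π∈S_k} G^π`, where `G` has
i.i.d. `N(0,1)` entries and `(G^π)_{i₁…i_k} = G_{i_{π(1)},…,i_{π(k)}}`. -/
def symNoise (k n : ℕ) : Measure ((Fin k → Fin n) → ℝ) :=
  (stdGaussianPi (Fin k → Fin n)).map
    fun g idx => (1 / (Nat.factorial k : ℝ)) * Real.sqrt (2 / n) *
      ∑ π : Equiv.Perm (Fin k), g (idx ∘ π)

/-- Law of the spiked symmetric tensor `X = β v^{⊗k} + Z`, with `v` uniform on the unit sphere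
and `Z` an independent symmetric standard normal tensor. -/
def spikedSymTensor (k n : ℕ) (β : ℝ) : Measure ((Fin k → Fin n) → ℝ) :=
  ((sphereUniform n).prod (symNoise k n)).map
    fun p idx => β * (∏ j, p.1 (idx j)) + p.2 idx

/-- The first coordinate `⟨v, e₁⟩` of a vector in `ℝⁿ` (junk value `0` if `n = 0`). -/
def firstCoord {n : ℕ} (v : EuclideanSpace ℝ (Fin n)) : ℝ :=
  if h : 0 < n then v ⟨0, h⟩ else 0

theorem pi_withDensity {ι : Type*} [Fintype ι] {X : ι → Type*} [∀ i, MeasurableSpace (X i)]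
    (μ : ∀ i, Measure (X i)) [∀ i, IsProbabilityMeasure (μ i)] {f : ∀ i, X i → ℝ≥0∞}
    (hf : ∀ i, Measurable (f i)) [∀ i, SigmaFinite ((μ i).withDensity (f i))] :
    Measure.pi (fun i => (μ i).withDensity (f i)) =
      (Measure.pi μ).withDensity (fun x => ∏ i, f i (x i)) := by
  refine Measure.pi_eq fun s hs => ?_
  have hind : ∀ i, Measurable ((s i).indicator (f i)) := fun i => (hf i).indicator (hs i)
  have hprod : (Set.univ.pi s).indicator (fun x : ∀ i, X i => ∏ i, f i (x i)) =
      fun x => ∏ i, (s i).indicator (f i) (x i) := by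
    classical
    ext x
    by_cases hx : x ∈ Set.univ.pi s
    · rw [Set.indicator_of_mem hx]
      exact Finset.prod_congr rfl fun i _ =>
        (Set.indicator_of_mem (hx i (Set.mem_univ i)) _).symm
    · rw [Set.indicator_of_notMem hx]
      obtain ⟨i, hi⟩ : ∃ i, x i ∉ s i := by simpa [Set.mem_pi] using hx
      exact (Finset.prod_eq_zero (Finset.mem_univ i) (Set.indicator_of_notMem hi _)).symm
  rw [withDensity_apply _ (MeasurableSet.univ_pi hs),
    ← lintegral_indicator (MeasurableSet.univ_pi hs), hprod,
    lintegral_prod_eq_prod_lintegral_of_indepFun Finset.univ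
      (fun i (x : ∀ i, X i) => (s i).indicator (f i) (x i))
      (iIndepFun_pi fun i => (hind i).aemeasurable)
      (fun i => (hind i).comp (measurable_pi_apply i))]
  refine Finset.prod_congr rfl fun i _ => ?_
  rw [(measurePreserving_eval μ i).lintegral_comp (hind i), lintegral_indicator (hs i),
    withDensity_apply _ (hs i)]

theorem gaussianReal_eq_withDensity_exp (a : ℝ) :
    gaussianReal a 1 = (gaussianReal 0 1).withDensity
      fun x => ENNReal.ofReal (Real.exp (a * x - a ^ 2 / 2)) := by
  rw [gaussianReal_of_var_ne_zero a one_ne_zero, gaussianReal_of_var_ne_zero 0 one_ne_zero,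
    ← withDensity_mul _ (measurable_gaussianPDF 0 1) (by fun_prop)]
  congr 1
  ext x
  simp only [Pi.mul_apply, gaussianPDF, gaussianPDFReal]
  rw [← ENNReal.ofReal_mul (by positivity), mul_assoc _ (Real.exp _), ← Real.exp_add]
  congr 3
  simp
  ring

instance (ι : Type*) [Fintype ι] : IsProbabilityMeasure (stdGaussianPi ι) := by
  unfold stdGaussianPi; infer_instance

/-- The Cameron–Martin formula for a standard Gaussian vector. -/
theorem stdGaussianPi_map_add {ι : Type*} [Fintype ι] (a : ι → ℝ) :
    (stdGaussianPi ι).map (fun g => g + a) = (stdGaussianPi ι).withDensity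
      fun g => ENNReal.ofReal (Real.exp (∑ i, a i * g i - (∑ i, a i ^ 2) / 2)) := by
  have hshift : (stdGaussianPi ι).map (fun g => g + a) =
      Measure.pi fun i => gaussianReal (a i) 1 := by
    have h := Measure.pi_map_pi (μ := fun _ : ι => gaussianReal 0 1)
      (f := fun i (x : ℝ) => x + a i) (fun i => (measurable_add_const (a i)).aemeasurable)
    simp only [gaussianReal_map_add_const, zero_add] at h
    exact h
  have hσ (i : ι) : SigmaFinite ((gaussianReal 0 1).withDensity
      fun x => ENNReal.ofReal (Real.exp (a i * x - a i ^ 2 / 2))) := by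
    rw [← gaussianReal_eq_withDensity_exp]; infer_instance
  rw [hshift]
  rw [funext fun i => gaussianReal_eq_withDensity_exp (a i),
    pi_withDensity (fun _ : ι => gaussianReal 0 1) (fun i => by fun_prop)]
  unfold stdGaussianPi
  congr 1
  ext g
  rw [← ENNReal.ofReal_prod_of_nonneg fun i _ => (Real.exp_pos _).le, ← Real.exp_sum,
    Finset.sum_sub_distrib, Finset.sum_div]

theorem lintegral_exp_stdGaussianPi {ι : Type*} [Fintype ι] (b : ι → ℝ) :
    ∫⁻ g, ENNReal.ofReal (Real.exp (∑ i, b i * g i)) ∂stdGaussianPi ι =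
      ENNReal.ofReal (Real.exp ((∑ i, b i ^ 2) / 2)) := by
  have hmass := congrArg (fun μ => μ Set.univ) (stdGaussianPi_map_add b)
  beta_reduce at hmass
  rw [Measure.map_apply (measurable_add_const b) MeasurableSet.univ, Set.preimage_univ,
    measure_univ, withDensity_apply _ MeasurableSet.univ, Measure.restrict_univ] at hmass
  have hsplit (g : ι → ℝ) : ENNReal.ofReal (Real.exp (∑ i, b i * g i)) =
      ENNReal.ofReal (Real.exp ((∑ i, b i ^ 2) / 2)) *
        ENNReal.ofReal (Real.exp (∑ i, b i * g i - (∑ i, b i ^ 2) / 2)) := by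
    rw [← ENNReal.ofReal_mul (Real.exp_pos _).le, ← Real.exp_add]
    congr 2
    ring
  simp_rw [hsplit]
  rw [lintegral_const_mul _ (by fun_prop), ← hmass, mul_one]

theorem sphereUniform_eq_map_stdGaussian (n : ℕ) :
    sphereUniform n =
      (stdGaussian (EuclideanSpace ℝ (Fin n))).map fun v => ‖v‖⁻¹ • v := by
  rw [← map_pi_eq_stdGaussian]
  rfl

instance (n : ℕ) : IsProbabilityMeasure (sphereUniform n) := by
  rw [sphereUniform_eq_map_stdGaussian]
  exact Measure.isProbabilityMeasure_map (by fun_prop)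

theorem sphereUniform_map_linearIsometryEquiv {n : ℕ}
    (e : EuclideanSpace ℝ (Fin n) ≃ₗᵢ[ℝ] EuclideanSpace ℝ (Fin n)) :
    (sphereUniform n).map e = sphereUniform n := by
  have he : Measurable e := e.continuous.measurable
  have hN : Measurable fun v : EuclideanSpace ℝ (Fin n) => ‖v‖⁻¹ • v := by fun_prop
  conv_rhs => rw [sphereUniform_eq_map_stdGaussian, ← stdGaussian_map e,
    Measure.map_map hN he]
  rw [sphereUniform_eq_map_stdGaussian, Measure.map_map he hN]
  congr 1
  ext1 v
  simp

theorem ae_norm_eq_one_sphereUniform {n : ℕ} (hn : 1 ≤ n) :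
    ∀ᵐ v ∂sphereUniform n, ‖v‖ = 1 := by
  have : Nonempty (Fin n) := ⟨⟨0, hn⟩⟩
  have hG : NullSingletonClass (gaussianReal 0 1) := nullSingletonClass_gaussianReal one_ne_zero
  have hpi : ∀ᵐ x ∂Measure.pi (fun _ : Fin n => gaussianReal 0 1), x ≠ 0 :=
    measure_eq_zero_iff_ae_notMem.1 (measure_singleton 0)
  rw [sphereUniform_eq_map_stdGaussian, ← map_pi_eq_stdGaussian,
    ae_map_iff (by fun_prop) (measurableSet_eq_fun (by fun_prop) (by fun_prop)),
    ae_map_iff (by fun_prop) (measurableSet_eq_fun (by fun_prop) (by fun_prop))]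
  filter_upwards [hpi] with x hx
  have hx' : WithLp.toLp 2 x ≠ 0 := by simpa using hx
  rw [norm_smul, norm_inv, norm_norm, inv_mul_cancel₀ (norm_ne_zero_iff.2 hx')]

theorem firstCoord_eq {n : ℕ} (hn : 1 ≤ n) (v : EuclideanSpace ℝ (Fin n)) :
    firstCoord v = v ⟨0, hn⟩ := dif_pos hn

theorem lintegral_sphereUniform_inner {n : ℕ} (hn : 1 ≤ n)
    {w : EuclideanSpace ℝ (Fin n)} (hw : ‖w‖ = 1) {f : ℝ → ℝ≥0∞} (hf : Measurable f) :
    ∫⁻ v, f (inner ℝ v w) ∂sphereUniform n = ∫⁻ v, f (firstCoord v) ∂sphereUniform n := by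
  set e₁ : EuclideanSpace ℝ (Fin n) := EuclideanSpace.single ⟨0, hn⟩ 1 with he₁
  have hfirst (v : EuclideanSpace ℝ (Fin n)) : firstCoord v = inner ℝ v e₁ := by
    rw [firstCoord_eq hn, he₁, EuclideanSpace.inner_single_right]
    simp
  set R := (Submodule.span ℝ {w - e₁})ᗮ.reflection with hR
  have hRw : R w = e₁ := Submodule.reflection_sub (by simp [hw, he₁])
  simp_rw [hfirst]
  conv_rhs => rw [← sphereUniform_map_linearIsometryEquiv R]
  rw [lintegral_map (by fun_prop) R.continuous.measurable]
  simp_rw [← hRw, LinearIsometryEquiv.inner_map_map]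

/-- The entries of the rank-one tensor `v^{⊗k}`. -/
def tensorPow (k : ℕ) {n : ℕ} (v : EuclideanSpace ℝ (Fin n)) (idx : Fin k → Fin n) : ℝ :=
  ∏ j, v (idx j)

@[fun_prop]
theorem measurable_tensorPow (k n : ℕ) :
    Measurable (tensorPow k : EuclideanSpace ℝ (Fin n) → (Fin k → Fin n) → ℝ) := by
  unfold tensorPow; fun_prop

theorem tensorPow_comp_perm {k n : ℕ} (v : EuclideanSpace ℝ (Fin n)) (idx : Fin k → Fin n)
    (π : Equiv.Perm (Fin k)) : tensorPow k v (idx ∘ π) = tensorPow k v idx :=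
  Equiv.prod_comp π fun j => v (idx j)

theorem sum_tensorPow_mul_tensorPow (k : ℕ) {n : ℕ} (v w : EuclideanSpace ℝ (Fin n)) :
    ∑ idx, tensorPow k v idx * tensorPow k w idx = inner ℝ v w ^ k := by
  simp only [tensorPow, ← Finset.prod_mul_distrib]
  rw [← Fintype.sum_pow (fun i => v i * w i) k]
  simp [PiLp.inner_apply, mul_comm]

/-- The normalized symmetrization `G ↦ (1/k!)·√(2/n)·Σ_π G^π`. -/
def symmetrize (k n : ℕ) (g : (Fin k → Fin n) → ℝ) (idx : Fin k → Fin n) : ℝ :=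
  (1 / (Nat.factorial k : ℝ)) * Real.sqrt (2 / n) * ∑ π : Equiv.Perm (Fin k), g (idx ∘ π)

@[fun_prop]
theorem measurable_symmetrize (k n : ℕ) : Measurable (symmetrize k n) := by
  unfold symmetrize; fun_prop

theorem symNoise_eq_map_symmetrize (k n : ℕ) :
    symNoise k n = (stdGaussianPi (Fin k → Fin n)).map (symmetrize k n) := rfl

instance (k n : ℕ) : IsProbabilityMeasure (symNoise k n) := by
  rw [symNoise_eq_map_symmetrize]
  exact Measure.isProbabilityMeasure_map (by fun_prop)

theorem symmetrize_add {k n : ℕ} (g h : (Fin k → Fin n) → ℝ) :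
    symmetrize k n (g + h) = symmetrize k n g + symmetrize k n h := by
  ext idx
  simp [symmetrize, Finset.sum_add_distrib, mul_add]

theorem symmetrize_smul_tensorPow (k : ℕ) {n : ℕ} (t : ℝ) (v : EuclideanSpace ℝ (Fin n)) :
    symmetrize k n (t • tensorPow k v) = (Real.sqrt (2 / n) * t) • tensorPow k v := by
  ext idx
  have hk : (Nat.factorial k : ℝ) ≠ 0 := by positivity
  simp only [symmetrize, Pi.smul_apply, smul_eq_mul, tensorPow_comp_perm, Finset.sum_const,
    Finset.card_univ, Fintype.card_perm, Fintype.card_fin, nsmul_eq_mul]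
  field_simp

theorem sum_tensorPow_mul_symmetrize {k n : ℕ} (v : EuclideanSpace ℝ (Fin n))
    (g : (Fin k → Fin n) → ℝ) :
    ∑ idx, tensorPow k v idx * symmetrize k n g idx =
      Real.sqrt (2 / n) * ∑ idx, tensorPow k v idx * g idx := by
  have hk : (Nat.factorial k : ℝ) ≠ 0 := by positivity
  have hperm (π : Equiv.Perm (Fin k)) :
      ∑ idx, tensorPow k v idx * g (idx ∘ π) = ∑ idx, tensorPow k v idx * g idx := by
    rw [← Equiv.sum_comp (Equiv.arrowCongr π.symm (Equiv.refl (Fin n)))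
      fun idx => tensorPow k v idx * g idx]
    refine Finset.sum_congr rfl fun idx _ => ?_
    change _ = tensorPow k v (idx ∘ π) * g (idx ∘ π)
    rw [tensorPow_comp_perm]
  calc ∑ idx, tensorPow k v idx * symmetrize k n g idx
      = (1 / (Nat.factorial k : ℝ)) * Real.sqrt (2 / n) *
          ∑ π : Equiv.Perm (Fin k), ∑ idx, tensorPow k v idx * g (idx ∘ π) := by
        rw [Finset.sum_comm, Finset.mul_sum]
        refine Finset.sum_congr rfl fun idx _ => ?_
        rw [symmetrize, ← Finset.mul_sum]
        ring
    _ = Real.sqrt (2 / n) * ∑ idx, tensorPow k v idx * g idx := by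
        simp only [hperm, Finset.sum_const, Finset.card_univ, Fintype.card_perm,
          Fintype.card_fin, nsmul_eq_mul]
        field_simp

/-- The likelihood ratio of `β v^{⊗k} + Z` against `Z`, for a fixed unit vector `v`. -/
def spikeLikelihood (k n : ℕ) (β : ℝ) (v : EuclideanSpace ℝ (Fin n))
    (z : (Fin k → Fin n) → ℝ) : ℝ≥0∞ :=
  ENNReal.ofReal (Real.exp (n * β / 2 * ∑ idx, tensorPow k v idx * z idx - n * β ^ 2 / 4))

theorem measurable_uncurry_spikeLikelihood (k n : ℕ) (β : ℝ) :
    Measurable (Function.uncurry (spikeLikelihood k n β)) := by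
  unfold spikeLikelihood Function.uncurry; fun_prop

theorem measurable_spikeLikelihood_comp {Ω : Type*} [MeasurableSpace Ω] {k n : ℕ} (β : ℝ)
    {v : Ω → EuclideanSpace ℝ (Fin n)} {z : Ω → (Fin k → Fin n) → ℝ}
    (hv : Measurable v) (hz : Measurable z) :
    Measurable fun ω => spikeLikelihood k n β (v ω) (z ω) := by
  unfold spikeLikelihood; fun_prop

theorem sqrt_two_div_mul_sqrt_half {n : ℕ} (hn : 1 ≤ n) :
    Real.sqrt (2 / n) * Real.sqrt (n / 2) = 1 := by
  have hn' : (n : ℝ) ≠ 0 := by positivity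
  rw [← Real.sqrt_mul (by positivity), show (2 / n * (n / 2) : ℝ) = 1 by field_simp,
    Real.sqrt_one]

theorem spikeLikelihood_symmetrize {k n : ℕ} (hn : 1 ≤ n) (β : ℝ)
    (v : EuclideanSpace ℝ (Fin n)) (g : (Fin k → Fin n) → ℝ) :
    spikeLikelihood k n β v (symmetrize k n g) = ENNReal.ofReal (Real.exp
      (∑ idx, (Real.sqrt (n / 2) * β * tensorPow k v idx) * g idx - n * β ^ 2 / 4)) := by
  have hs := sqrt_two_div_mul_sqrt_half hn
  have hsq : Real.sqrt (n / 2) * Real.sqrt (n / 2) = n / 2 := Real.mul_self_sqrt (by positivity)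
  have hc : n * β / 2 * Real.sqrt (2 / n) = Real.sqrt (n / 2) * β := by
    linear_combination (-β * Real.sqrt (2 / n)) * hsq + (β * Real.sqrt (n / 2)) * hs
  rw [spikeLikelihood, sum_tensorPow_mul_symmetrize, ← mul_assoc, hc, Finset.mul_sum]
  simp only [mul_assoc]

theorem symNoise_map_add_spike {k n : ℕ} (hn : 1 ≤ n) (β : ℝ)
    {v : EuclideanSpace ℝ (Fin n)} (hv : ‖v‖ = 1) :
    (symNoise k n).map (fun z => β • tensorPow k v + z) =
      (symNoise k n).withDensity (spikeLikelihood k n β v) := by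
  have hs := sqrt_two_div_mul_sqrt_half hn
  have hL : Measurable (spikeLikelihood k n β v) :=
    (measurable_uncurry_spikeLikelihood k n β).of_uncurry_left
  set a : (Fin k → Fin n) → ℝ := (Real.sqrt (n / 2) * β) • tensorPow k v with ha
  have hsym : symmetrize k n a = β • tensorPow k v := by
    rw [ha, symmetrize_smul_tensorPow, ← mul_assoc, hs, one_mul]
  have hnorm : (∑ i, a i ^ 2) / 2 = n * β ^ 2 / 4 := by
    have h := sum_tensorPow_mul_tensorPow k v v
    rw [real_inner_self_eq_norm_sq, hv] at h
    simp only [ha, Pi.smul_apply, smul_eq_mul, mul_pow, ← Finset.mul_sum]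
    rw [Real.sq_sqrt (by positivity)]
    simp only [pow_two (tensorPow k v _), h]
    ring
  have hdens : spikeLikelihood k n β v ∘ symmetrize k n =
      fun g => ENNReal.ofReal (Real.exp (∑ i, a i * g i - (∑ i, a i ^ 2) / 2)) := by
    ext g
    rw [hnorm]
    exact spikeLikelihood_symmetrize hn β v g
  have hshift : (fun z => β • tensorPow k v + z) ∘ symmetrize k n =
      symmetrize k n ∘ fun g => g + a := by
    ext1 g
    simp [symmetrize_add, hsym, add_comm]
  rw [symNoise_eq_map_symmetrize, Measure.map_map (by fun_prop) (by fun_prop), hshift,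
    ← Measure.map_map (by fun_prop) (by fun_prop), stdGaussianPi_map_add, ← hdens]
  ext s hs'
  rw [Measure.map_apply (by fun_prop) hs', withDensity_apply _ hs',
    withDensity_apply _ (measurable_symmetrize k n hs'),
    setLIntegral_map hs' hL (measurable_symmetrize k n)]
  rfl

theorem lintegral_spikeLikelihood_mul {k n : ℕ} (hn : 1 ≤ n) (β : ℝ)
    {v w : EuclideanSpace ℝ (Fin n)} (hv : ‖v‖ = 1) (hw : ‖w‖ = 1) :
    ∫⁻ z, spikeLikelihood k n β v z * spikeLikelihood k n β w z ∂symNoise k n =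
      ENNReal.ofReal (Real.exp (n * β ^ 2 / 2 * inner ℝ v w ^ k)) := by
  have hL (u : EuclideanSpace ℝ (Fin n)) : Measurable (spikeLikelihood k n β u) :=
    (measurable_uncurry_spikeLikelihood k n β).of_uncurry_left
  set b : (Fin k → Fin n) → ℝ :=
    fun idx => Real.sqrt (n / 2) * β * (tensorPow k v idx + tensorPow k w idx) with hb
  have hnorm : (∑ i, b i ^ 2) / 2 = n * β ^ 2 / 2 + n * β ^ 2 / 2 * inner ℝ v w ^ k := by
    have hvv := sum_tensorPow_mul_tensorPow k v v
    have hww := sum_tensorPow_mul_tensorPow k w w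
    have hvw := sum_tensorPow_mul_tensorPow k v w
    rw [real_inner_self_eq_norm_sq, hv, one_pow, one_pow] at hvv
    rw [real_inner_self_eq_norm_sq, hw, one_pow, one_pow] at hww
    have hexp (i) : b i ^ 2 = n / 2 * β ^ 2 * (tensorPow k v i * tensorPow k v i +
        2 * (tensorPow k v i * tensorPow k w i) + tensorPow k w i * tensorPow k w i) := by
      rw [hb]
      simp only [mul_pow]
      rw [Real.sq_sqrt (by positivity)]
      ring
    simp only [hexp, ← Finset.mul_sum, Finset.sum_add_distrib, hvv, hww, hvw]
    ring
  have hprod (g : (Fin k → Fin n) → ℝ) :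
      spikeLikelihood k n β v (symmetrize k n g) * spikeLikelihood k n β w (symmetrize k n g) =
        ENNReal.ofReal (Real.exp (-(n * β ^ 2 / 2))) *
          ENNReal.ofReal (Real.exp (∑ i, b i * g i)) := by
    rw [spikeLikelihood_symmetrize hn, spikeLikelihood_symmetrize hn,
      ← ENNReal.ofReal_mul (Real.exp_pos _).le, ← ENNReal.ofReal_mul (Real.exp_pos _).le,
      ← Real.exp_add, ← Real.exp_add]
    simp only [hb, mul_add, add_mul, Finset.sum_add_distrib]
    congr 2
    ring
  rw [symNoise_eq_map_symmetrize, lintegral_map (by fun_prop) (by fun_prop)]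
  simp_rw [hprod]
  rw [lintegral_const_mul _ (by fun_prop), lintegral_exp_stdGaussianPi, hnorm,
    ← ENNReal.ofReal_mul (Real.exp_pos _).le, ← Real.exp_add]
  congr 2
  ring

theorem spikedSymTensor_eq_withDensity {k n : ℕ} (hn : 1 ≤ n) (β : ℝ) :
    spikedSymTensor k n β = (symNoise k n).withDensity
      fun z => ∫⁻ v, spikeLikelihood k n β v z ∂sphereUniform n := by
  have hL := measurable_uncurry_spikeLikelihood k n β
  have hF : Measurable fun p : EuclideanSpace ℝ (Fin n) × ((Fin k → Fin n) → ℝ) =>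
      β • tensorPow k p.1 + p.2 := by fun_prop
  ext s hs
  change ((sphereUniform n).prod (symNoise k n)).map
    (fun p => β • tensorPow k p.1 + p.2) s = _
  rw [Measure.map_apply hF hs, Measure.prod_apply (hF hs), withDensity_apply _ hs,
    lintegral_lintegral_swap (f := fun z v => spikeLikelihood k n β v z)
      (hL.comp measurable_swap).aemeasurable]
  refine lintegral_congr_ae ?_
  filter_upwards [ae_norm_eq_one_sphereUniform hn] with v hv
  rw [← withDensity_apply _ hs, ← symNoise_map_add_spike hn β hv,
    Measure.map_apply (by fun_prop) hs]
  rfl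

/-- `P_β ≪ P_0` and the second moment of the Radon–Nikodym derivative
`Λ = dP_β/dP_0` is `∫ exp((nβ²/2)⟨v,e₁⟩^k) μ_n(dv)`. -/
theorem second_moment_formula
    (k n : ℕ) (hk : 2 ≤ k) (hn : 1 ≤ n) (β : ℝ) (hβ : 0 ≤ β) :
    spikedSymTensor k n β ≪ symNoise k n ∧
    ∫⁻ x, ((spikedSymTensor k n β).rnDeriv (symNoise k n) x) ^ 2 ∂(symNoise k n)
      = ENNReal.ofReal
          (∫ v, Real.exp ((n * β ^ 2 / 2) * (firstCoord v) ^ k) ∂(sphereUniform n)) := by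
  have hL := measurable_uncurry_spikeLikelihood k n β
  have hLv (u : EuclideanSpace ℝ (Fin n)) : Measurable (spikeLikelihood k n β u) :=
    hL.of_uncurry_left
  have hLz (z : (Fin k → Fin n) → ℝ) : Measurable fun v => spikeLikelihood k n β v z :=
    hL.of_uncurry_right
  have hLL (w : EuclideanSpace ℝ (Fin n)) : Measurable (Function.uncurry fun z v =>
      spikeLikelihood k n β v z * spikeLikelihood k n β w z) :=
    (hL.comp measurable_swap).mul ((hLv w).comp measurable_fst)
  have hLLz : Measurable (Function.uncurry fun z w =>
      ∫⁻ v, spikeLikelihood k n β v z * spikeLikelihood k n β w z ∂sphereUniform n) := by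
    have hq := (measurable_spikeLikelihood_comp (k := k) (n := n) β
      (Ω := (((Fin k → Fin n) → ℝ) × EuclideanSpace ℝ (Fin n)) × EuclideanSpace ℝ (Fin n))
      measurable_snd (measurable_fst.comp measurable_fst)).mul
        (measurable_spikeLikelihood_comp β (measurable_snd.comp measurable_fst)
          (measurable_fst.comp measurable_fst))
    exact hq.lintegral_prod_right'
  have hΛ : Measurable fun z => ∫⁻ v, spikeLikelihood k n β v z ∂sphereUniform n :=
    (hL.comp measurable_swap).lintegral_prod_right'
  have hunit := ae_norm_eq_one_sphereUniform hn
  have hcoord : Measurable (firstCoord : EuclideanSpace ℝ (Fin n) → ℝ) := by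
    rw [funext fun v => firstCoord_eq hn v]
    fun_prop
  rw [spikedSymTensor_eq_withDensity hn β]
  refine ⟨withDensity_absolutelyContinuous _ _, ?_⟩
  have hint : Integrable (fun v => Real.exp (n * β ^ 2 / 2 * firstCoord v ^ k))
      (sphereUniform n) := by
    refine Integrable.of_bound (by fun_prop) (Real.exp (n * β ^ 2 / 2)) ?_
    filter_upwards [hunit] with v hv
    rw [Real.norm_eq_abs, Real.abs_exp]
    refine Real.exp_le_exp.2 (mul_le_of_le_one_right (by positivity) ?_)
    refine (le_abs_self _).trans ?_
    rw [abs_pow]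
    refine pow_le_one₀ (abs_nonneg _) ?_
    rw [firstCoord_eq hn, ← hv]
    exact PiLp.norm_apply_le v _
  rw [ofReal_integral_eq_lintegral_ofReal hint (Eventually.of_forall fun v => (Real.exp_pos _).le)]
  calc ∫⁻ z, (((symNoise k n).withDensity
          fun z => ∫⁻ v, spikeLikelihood k n β v z ∂sphereUniform n).rnDeriv
            (symNoise k n) z) ^ 2 ∂symNoise k n
      = ∫⁻ z, ∫⁻ w, ∫⁻ v, spikeLikelihood k n β v z * spikeLikelihood k n β w z
          ∂sphereUniform n ∂sphereUniform n ∂symNoise k n := by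
        refine lintegral_congr_ae ?_
        filter_upwards [Measure.rnDeriv_withDensity (symNoise k n) hΛ] with z hz
        rw [hz, pow_two, ← lintegral_const_mul _ (hLz z)]
        exact lintegral_congr fun w => (lintegral_mul_const _ (hLz z)).symm
    _ = ∫⁻ w, ∫⁻ v, (∫⁻ z, spikeLikelihood k n β v z * spikeLikelihood k n β w z ∂symNoise k n)
          ∂sphereUniform n ∂sphereUniform n := by
        rw [lintegral_lintegral_swap hLLz.aemeasurable]
        exact lintegral_congr fun w => lintegral_lintegral_swap (hLL w).aemeasurable
    _ = ∫⁻ _, ∫⁻ v, ENNReal.ofReal (Real.exp (n * β ^ 2 / 2 * firstCoord v ^ k))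
          ∂sphereUniform n ∂sphereUniform n := by
        refine lintegral_congr_ae ?_
        filter_upwards [hunit] with w hw
        rw [← lintegral_sphereUniform_inner hn hw
          (f := fun t => ENNReal.ofReal (Real.exp (n * β ^ 2 / 2 * t ^ k))) (by fun_prop)]
        refine lintegral_congr_ae ?_
        filter_upwards [hunit] with v hv
        exact lintegral_spikeLikelihood_mul hn β hv hw
    _ = ∫⁻ v, ENNReal.ofReal (Real.exp (n * β ^ 2 / 2 * firstCoord v ^ k))
          ∂sphereUniform n := by
        rw [lintegral_const, measure_univ, mul_one]

end
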